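/- Let u and ψ(z) = az + b (with a, b ∈ ℂ, |a| ≤ 1) be entire functions on ℂ such that the weighted composition operator W_{(u,ψ)} is bounded on the Fock space 𝓕₂. If a^k = a for some integer k ≥ 2, then W_{(u,ψ)} is not cyclic on 𝓕₂. -/

import Mathlib

open MeasureTheory Finset

/-- Squared Fock-space norm: ‖f‖₂² = (1/π)∫_ℂ |f(z)|² e^{-|z|²} dA(z). -/
noncomputable def fockNormSq (f : ℂ → ℂ) : ℝ :=
  (1 / Real.pi) * ∫ z : ℂ, ‖f z‖ ^ 2 * Real.exp (-‖z‖ ^ 2)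

/-- Membership in the Fock space 𝓕₂: entire and square Gaussian-integrable. -/
def MemFock (f : ℂ → ℂ) : Prop :=
  Differentiable ℂ f ∧
  Integrable (fun z : ℂ => ‖f z‖ ^ 2 * Real.exp (-‖z‖ ^ 2))

/-- Fock-space inner product ⟨f,g⟩ = (1/π)∫_ℂ f(z)·conj(g(z))·e^{-|z|²} dA(z). -/
noncomputable def fockInner (f g : ℂ → ℂ) : ℂ :=
  (1 / (Real.pi : ℂ)) * ∫ z : ℂ, f z * (starRingEnd ℂ) (g z) * (Real.exp (-‖z‖ ^ 2) : ℂ)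

/-- Reproducing kernel of the Fock space: K_w(z) = e^{z·conj(w)}. -/
noncomputable def fockKernel (w : ℂ) : ℂ → ℂ :=
  fun z => Complex.exp (z * (starRingEnd ℂ) w)

/-- Weighted composition operator W_{(u,ψ)} f = u·(f∘ψ). -/
def wComp (u ψ : ℂ → ℂ) (f : ℂ → ℂ) : ℂ → ℂ := fun z => u z * f (ψ z)

/-- Composition operator C_ψ f = f∘ψ. -/
def compOp (ψ : ℂ → ℂ) (f : ℂ → ℂ) : ℂ → ℂ := fun z => f (ψ z)

/-- Multiplication operator M_u f = u·f. -/
def mulOp (u : ℂ → ℂ) (f : ℂ → ℂ) : ℂ → ℂ := fun z => u z * f z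

/-- T maps 𝓕₂ into 𝓕₂ and is bounded there. -/
def FockBoundedOp (T : (ℂ → ℂ) → ℂ → ℂ) : Prop :=
  (∀ f, MemFock f → MemFock (T f)) ∧
  ∃ C : ℝ, 0 ≤ C ∧ ∀ f, MemFock f → fockNormSq (T f) ≤ C * fockNormSq f

/-- f is a cyclic vector for T on 𝓕₂: the linear span of the orbit
{Tⁿ f : n ≥ 0} is dense in 𝓕₂. -/
def IsCyclicVec (T : (ℂ → ℂ) → ℂ → ℂ) (f : ℂ → ℂ) : Prop :=
  MemFock f ∧ ∀ g, MemFock g → ∀ ε : ℝ, 0 < ε →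
    ∃ (n : ℕ) (c : Fin n → ℂ),
      fockNormSq (fun z => (∑ i : Fin n, c i * T^[(i : ℕ)] f z) - g z) < ε

/-- T is cyclic on 𝓕₂. -/
def IsCyclicOp (T : (ℂ → ℂ) → ℂ → ℂ) : Prop := ∃ f, IsCyclicVec T f

/-- T is hypercyclic on 𝓕₂: some orbit {Tⁿ f : n ≥ 0} is dense. -/
def IsHypercyclicOp (T : (ℂ → ℂ) → ℂ → ℂ) : Prop :=
  ∃ f, MemFock f ∧ ∀ g, MemFock g → ∀ ε : ℝ, 0 < ε →
    ∃ n : ℕ, fockNormSq (fun z => T^[n] f z - g z) < ε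

/-- T is supercyclic on 𝓕₂: some projective orbit {λTⁿ f} is dense. -/
def IsSupercyclicOp (T : (ℂ → ℂ) → ℂ → ℂ) : Prop :=
  ∃ f, MemFock f ∧ ∀ g, MemFock g → ∀ ε : ℝ, 0 < ε →
    ∃ (lam : ℂ) (n : ℕ), fockNormSq (fun z => lam * T^[n] f z - g z) < ε

/-- T is invertible as a bounded operator on 𝓕₂. -/
def FockOpInvertible (T : (ℂ → ℂ) → ℂ → ℂ) : Prop :=
  (∀ f, MemFock f → MemFock (T f)) ∧
  ∃ S : (ℂ → ℂ) → ℂ → ℂ,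
    (∀ f, MemFock f → MemFock (S f)) ∧
    (∀ f, MemFock f → S (T f) = f) ∧
    (∀ f, MemFock f → T (S f) = f) ∧
    ∃ C : ℝ, 0 ≤ C ∧ ∀ f, MemFock f → fockNormSq (S f) ≤ C * fockNormSq f

/-- μ is an eigenvalue of the Hilbert-space adjoint W_{(u,ψ)}*, expressed via the
inner product: W* g = μ g for a nonzero g ∈ 𝓕₂, i.e. ⟨Wf, g⟩ = conj(μ)·⟨f, g⟩
for all f ∈ 𝓕₂. -/
def IsAdjointEigenvalue (u ψ : ℂ → ℂ) (μ : ℂ) : Prop :=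
  ∃ g, MemFock g ∧ g ≠ 0 ∧ ∀ f, MemFock f →
    fockInner (wComp u ψ f) g = (starRingEnd ℂ) μ * fockInner f g

open scoped ComplexConjugate InnerProductSpace

theorem eq_zero_of_anticommute_of_dense_orbit {E : Type*} [NormedAddCommGroup E]
    [InnerProductSpace ℂ E] (T A B : E ≃ₗᵢ[ℂ] E)
    (hTA : ∀ x, T (A x) = A (T x)) (hTB : ∀ x, T (B x) = B (T x))
    (hAB : ∀ x, A (B x) = -B (A x)) (f : E)
    (hf : ∀ g : E, ∀ ε : ℝ, 0 < ε →
      ∃ (n : ℕ) (c : Fin n → ℂ), ‖(∑ i, c i • T^[(i : ℕ)] f) - g‖ < ε) :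
    f = 0 := by
  let t : Module.End ℂ E := T.toLinearEquiv.toLinearMap
  let t' : Module.End ℂ E := T.symm.toLinearEquiv.toLinearMap
  let β : Module.End ℂ E := B.toLinearEquiv.toLinearMap
  have ht : ∀ (n : ℕ) x, T^[n] x = (t ^ n) x := fun n x => by
    rw [Module.End.pow_apply]; rfl
  have htt' : Commute t t' := by
    ext x; simp [t, t']
  have hA' : ∀ x, t' (A x) = A (t' x) := fun x => by
    apply T.injective
    simp [t', hTA]
  have htβ : Commute t β := by ext x; exact hTB x
  have ht'β : Commute t' β := by
    ext x
    apply T.injective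
    simp [t', β, hTB]
  have hadj : ∀ (n : ℕ) x y, ⟪(t ^ n) x, y⟫_ℂ = ⟪x, (t' ^ n) y⟫_ℂ := by
    intro n
    induction n with
    | zero => intro x y; simp
    | succ n ih =>
      intro x y
      rw [pow_succ, pow_succ', Module.End.mul_apply, ih, Module.End.mul_apply]
      exact LinearIsometryEquiv.inner_map_eq_flip T x _
  let P : (n : ℕ) → (Fin n → ℂ) → Module.End ℂ E := fun n c => ∑ i, c i • t ^ (i : ℕ)
  let P' : (n : ℕ) → (Fin n → ℂ) → Module.End ℂ E := fun n c => ∑ i, conj (c i) • t' ^ (i : ℕ)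
  have hPadj : ∀ n c x y, ⟪P n c x, y⟫_ℂ = ⟪x, P' n c y⟫_ℂ := by
    intro n c x y
    simp [P, P', hadj, mul_comm]
  have hPf : ∀ g : E, ∀ ε : ℝ, 0 < ε → ∃ n c, ‖P n c f - g‖ < ε := by
    intro g ε hε
    obtain ⟨n, c, h⟩ := hf g ε hε
    refine ⟨n, c, ?_⟩
    simpa [P, ht] using h
  have hPβ : ∀ n c, Commute (P n c) β := fun n c =>
    Commute.sum_left _ _ _ fun i _ => (htβ.pow_left _).smul_left _
  have hP'β : ∀ n c, Commute (P' n c) β := fun n c =>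
    Commute.sum_left _ _ _ fun i _ => (ht'β.pow_left _).smul_left _
  have hPP' : ∀ n c m d, Commute (P n c) (P' m d) := fun n c m d =>
    Commute.sum_left _ _ _ fun i _ => Commute.smul_left (Commute.sum_right _ _ _ fun j _ =>
      ((htt'.pow_pow _ _)).smul_right _) _
  let α : Module.End ℂ E := A.toLinearEquiv.toLinearMap
  let α' : Module.End ℂ E := A.symm.toLinearEquiv.toLinearMap
  have htα : Commute t α := by ext x; exact hTA x
  have ht'α : Commute t' α := by ext x; exact hA' x
  have hPα : ∀ n c, Commute (P n c) α := fun n c =>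
    Commute.sum_left _ _ _ fun i _ => (htα.pow_left _).smul_left _
  have hP'α : ∀ n c, Commute (P' n c) α := fun n c =>
    Commute.sum_left _ _ _ fun i _ => (ht'α.pow_left _).smul_left _
  have ap : ∀ {S R : Module.End ℂ E}, Commute S R → ∀ x, S (R x) = R (S x) :=
    fun h x => LinearMap.congr_fun h x
  -- normality of `P - A`
  have hnormal : ∀ n c x, ‖P' n c x - A.symm x‖ = ‖P n c x - A x‖ := by
    intro n c x
    have hαα' : Commute α α' := by ext x; simp [α, α']
    have hPα' : Commute (P n c) α' := by
      ext x
      apply A.injective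
      simpa [α, α'] using (ap (hPα n c) (A.symm x)).symm
    have hcomm : Commute (P n c - α) (P' n c - α') :=
      ((hPP' n c n c).sub_right hPα').sub_left ((hP'α n c).symm.sub_right hαα')
    have hadj' : ∀ y z, ⟪(P n c - α) y, z⟫_ℂ = ⟪y, (P' n c - α') z⟫_ℂ := by
      intro y z
      rw [LinearMap.sub_apply, LinearMap.sub_apply, inner_sub_left, inner_sub_right, hPadj]
      congr 1
      exact LinearIsometryEquiv.inner_map_eq_flip A y z
    have key : ⟪P' n c x - A.symm x, P' n c x - A.symm x⟫_ℂ
        = ⟪P n c x - A x, P n c x - A x⟫_ℂ := by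
      change ⟪(P' n c - α') x, (P' n c - α') x⟫_ℂ = ⟪(P n c - α) x, (P n c - α) x⟫_ℂ
      rw [hadj', ← ap hcomm, ← inner_conj_symm, ← hadj', inner_conj_symm]
    have h2 : ‖P' n c x - A.symm x‖ ^ 2 = ‖P n c x - A x‖ ^ 2 := by
      have := congrArg Complex.re key
      simpa [inner_self_eq_norm_sq_to_K, ← Complex.ofReal_pow] using this
    exact (sq_eq_sq₀ (norm_nonneg _) (norm_nonneg _)).1 h2
  have horth : ∀ m d, ⟪A (B f) - B (A f), P m d f⟫_ℂ = 0 := by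
    intro m d
    have hPB' : P m d (B.symm f) = B.symm (P m d f) := by
      apply B.injective
      simpa [β] using (ap (hPβ m d) (B.symm f)).symm
    set K : ℝ := ‖P m d (B.symm f)‖ + ‖B (P' m d f)‖
    have hbound : ∀ ε : ℝ, 0 < ε → ‖⟪A (B f) - B (A f), P m d f⟫_ℂ‖ ≤ ε * K := by
      intro ε hε
      obtain ⟨n, c, hc⟩ := hPf (A f) ε hε
      have hc' : ‖P' n c f - A.symm f‖ < ε := by rw [hnormal]; exact hc
      have e1 : ⟪A (B f), P m d f⟫_ℂ = ⟪B (P' m d f), A.symm f⟫_ℂ := by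
        rw [← inner_conj_symm, hPadj, inner_conj_symm, 
          show P' m d (A (B f)) = A (B (P' m d f)) from
            (ap (hP'α m d) (B f)).trans (congrArg A (ap (hP'β m d) f))]
        exact A.inner_map_eq_flip _ _
      have e2 : ⟪B (A f), P m d f⟫_ℂ = ⟪A f, P m d (B.symm f)⟫_ℂ := by
        rw [hPB']
        exact B.inner_map_eq_flip _ _
      have e3 : ⟪P n c f, P m d (B.symm f)⟫_ℂ = ⟪B (P' m d f), P' n c f⟫_ℂ := by
        rw [hPB', ← B.inner_map_eq_flip, ← hPadj]
        change ⟪β _, _⟫_ℂ = ⟪P n c (β _), _⟫_ℂ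
        rw [ap (hPβ n c), ap (hPP' n c m d), ← inner_conj_symm, hPadj, inner_conj_symm,
          ap (hP'β m d)]
      have e4 : ⟪A (B f) - B (A f), P m d f⟫_ℂ
          = ⟪P n c f - A f, P m d (B.symm f)⟫_ℂ - ⟪B (P' m d f), P' n c f - A.symm f⟫_ℂ := by
        rw [inner_sub_left, e1, e2, inner_sub_left, inner_sub_right, e3]; ring
      rw [e4]
      calc _ ≤ ‖P n c f - A f‖ * ‖P m d (B.symm f)‖ + ‖B (P' m d f)‖ * ‖P' n c f - A.symm f‖ :=
            (norm_sub_le _ _).trans <| add_le_add (norm_inner_le_norm _ _) (norm_inner_le_norm _ _)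
        _ ≤ ε * ‖P m d (B.symm f)‖ + ‖B (P' m d f)‖ * ε := by gcongr
        _ = ε * K := by ring
    have hK : 0 ≤ K := by positivity
    by_contra hne
    have hpos := norm_pos_iff.2 hne
    have := hbound (‖⟪A (B f) - B (A f), P m d f⟫_ℂ‖ / (2 * (K + 1))) (by positivity)
    rw [div_mul_eq_mul_div, le_div_iff₀ (by positivity)] at this
    nlinarith
  have hx : A (B f) - B (A f) = 0 := by
    by_contra hne
    have hpos := norm_pos_iff.2 hne
    set x := A (B f) - B (A f)
    obtain ⟨m, d, hd⟩ := hPf x ‖x‖ hpos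
    have h1 : ⟪x, x⟫_ℂ = -⟪x, P m d f - x⟫_ℂ := by
      rw [inner_sub_right x (P m d f) x, horth, zero_sub, neg_neg]
    have h2 : ‖x‖ * ‖x‖ = ‖⟪x, P m d f - x⟫_ℂ‖ := by
      rw [← norm_neg ⟪x, P m d f - x⟫_ℂ, ← h1]; simp [inner_self_eq_norm_sq_to_K, sq]
    have h3 := norm_inner_le_norm (𝕜 := ℂ) x (P m d f - x)
    nlinarith
  have h0 : B (A f) = 0 := by
    rw [hAB, ← neg_add', neg_eq_zero, ← two_smul ℂ] at hx
    simpa using hx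
  simpa using h0

theorem integrable_exp_neg_normSq : Integrable (fun z : ℂ => Real.exp (-‖z‖ ^ 2)) := by
  have h := (GaussianFourier.integrable_cexp_neg_mul_sq_norm_add (V := ℂ) (b := 1)
    (by simp) 0 0).norm
  refine h.congr (Filter.Eventually.of_forall fun z => ?_)
  simp [Complex.norm_exp, ← Complex.ofReal_pow]

theorem integral_exp_neg_normSq : ∫ z : ℂ, Real.exp (-‖z‖ ^ 2) = Real.pi := by
  have h := GaussianFourier.integral_cexp_neg_mul_sq_norm (V := ℂ) (b := 1) (by simp)
  have h2 : (fun z : ℂ => Complex.exp (-1 * (‖z‖ : ℂ) ^ 2))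
      = fun z : ℂ => ((Real.exp (-‖z‖ ^ 2) : ℝ) : ℂ) := by
    ext z; simp
  rw [h2, integral_complex_ofReal] at h
  simp at h
  exact_mod_cast h

theorem integral_mul_exp_neg_normSq {g : ℂ → ℂ} (hg : Differentiable ℂ g)
    (hi : Integrable (fun z : ℂ => g z * (Real.exp (-‖z‖ ^ 2) : ℂ))) :
    ∫ z : ℂ, g z * (Real.exp (-‖z‖ ^ 2) : ℂ) = Real.pi * g 0 := by
  let F : ℂ → ℝ → ℂ := fun z θ => g (circleMap 0 1 θ * z) * (Real.exp (-‖z‖ ^ 2) : ℂ)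
  have hrot : ∀ θ : ℝ, ∃ R : ℂ ≃ₗᵢ[ℝ] ℂ, ∀ z, R z = circleMap 0 1 θ * z := by
    intro θ
    refine ⟨rotation (Circle.exp θ), fun z => ?_⟩
    simp [circleMap]
  have hF : ∀ θ R, (∀ z, R z = circleMap 0 1 θ * z) →
      (fun z => F z θ) = (fun z : ℂ => g z * (Real.exp (-‖z‖ ^ 2) : ℂ)) ∘ (R : ℂ ≃ₗᵢ[ℝ] ℂ) := by
    intro θ R hR
    ext z
    simp only [F, Function.comp, R.norm_map, ← hR]
  have hFint : ∀ θ, Integrable (fun z => F z θ) := by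
    intro θ
    obtain ⟨R, hR⟩ := hrot θ
    rw [hF θ R hR]
    exact R.measurePreserving.integrable_comp_of_integrable hi
  have hFval : ∀ θ, ∫ z, F z θ = ∫ z : ℂ, g z * (Real.exp (-‖z‖ ^ 2) : ℂ) := by
    intro θ
    obtain ⟨R, hR⟩ := hrot θ
    rw [hF θ R hR]
    exact R.measurePreserving.integral_comp R.toHomeomorph.measurableEmbedding
      (fun z : ℂ => g z * (Real.exp (-‖z‖ ^ 2) : ℂ))
  have hFnorm : ∀ θ, ∫ z, ‖F z θ‖ = ∫ z : ℂ, ‖g z * (Real.exp (-‖z‖ ^ 2) : ℂ)‖ := by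
    intro θ
    obtain ⟨R, hR⟩ := hrot θ
    have := hF θ R hR
    rw [← R.measurePreserving.integral_comp R.toHomeomorph.measurableEmbedding
      (fun z : ℂ => ‖g z * (Real.exp (-‖z‖ ^ 2) : ℂ)‖)]
    congr 1
    ext z
    exact congrArg norm (congrFun this z)
  have hcont : Continuous (Function.uncurry F) := by
    have := hg.continuous
    have h2 := continuous_circleMap 0 1
    simp only [F, Function.uncurry_def]
    fun_prop
  have hprod : Integrable (Function.uncurry F)
      ((volume : Measure ℂ).prod (volume.restrict (Set.uIoc 0 (2 * Real.pi)))) := by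
    rw [integrable_prod_iff' hcont.aestronglyMeasurable]
    refine ⟨Filter.Eventually.of_forall hFint, ?_⟩
    simp only [Function.uncurry, hFnorm]
    rw [Set.uIoc_of_le (by positivity)]
    exact integrable_const _
  have hswap := intervalIntegral_integral_swap (f := fun θ z => F z θ) (μ := volume)
    (a := 0) (b := 2 * Real.pi) hprod.swap
  have hmean : ∀ z, ∫ θ in (0 : ℝ)..(2 * Real.pi), F z θ
      = (2 * Real.pi) * g 0 * (Real.exp (-‖z‖ ^ 2) : ℂ) := by
    intro z
    have hd : Differentiable ℂ (fun w => g (w * z)) := by fun_prop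
    have h := (hd.diffContOnCl (s := Metric.ball 0 |1|)).circleAverage
    rw [Real.circleAverage_def] at h
    simp only [F, intervalIntegral.integral_mul_const]
    simp only [zero_mul] at h
    rw [← h, Complex.real_smul]
    have : (Real.pi : ℂ) ≠ 0 := by exact_mod_cast Real.pi_ne_zero
    push_cast
    field_simp
    simp only [mul_comm z]
  simp only [hmean, hFval, intervalIntegral.integral_const] at hswap
  rw [integral_const_mul, integral_complex_ofReal, integral_exp_neg_normSq] at hswap
  have hpi : (Real.pi : ℂ) ≠ 0 := by exact_mod_cast Real.pi_ne_zero
  have h2 : (2 * (Real.pi : ℂ)) * ∫ z : ℂ, g z * (Real.exp (-‖z‖ ^ 2) : ℂ)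
      = (2 * Real.pi) * (Real.pi * g 0) := by
    rw [sub_zero, Complex.real_smul] at hswap
    push_cast at hswap ⊢
    rw [hswap]; ring
  exact mul_left_cancel₀ (mul_ne_zero two_ne_zero hpi) h2

theorem norm_sq_apply_zero_le_fockNormSq {f : ℂ → ℂ} (hf : MemFock f) :
    ‖f 0‖ ^ 2 ≤ fockNormSq f := by
  have hi : Integrable (fun z : ℂ => f z ^ 2 * (Real.exp (-‖z‖ ^ 2) : ℂ)) := by
    refine hf.2.mono' ?_ (Filter.Eventually.of_forall fun z => ?_)
    · have := hf.1.continuous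
      exact Continuous.aestronglyMeasurable (by fun_prop)
    · simp [Complex.norm_exp, ← Complex.ofReal_pow]
  have h := integral_mul_exp_neg_normSq (hf.1.pow 2) hi
  have h2 := norm_integral_le_integral_norm (μ := volume)
    (fun z : ℂ => f z ^ 2 * (Real.exp (-‖z‖ ^ 2) : ℂ))
  simp only [Pi.pow_apply] at h
  rw [h] at h2
  simp only [norm_mul, norm_pow, Complex.norm_real, Real.norm_eq_abs, Real.abs_exp,
    abs_of_pos Real.pi_pos] at h2
  rw [fockNormSq, div_mul_eq_mul_div, one_mul, le_div_iff₀ Real.pi_pos]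
  linarith

/-- The Weyl operator with parameter `c`, a translation by `c` made unitary on the Fock space. -/
noncomputable def weyl (c : ℂ) (f : ℂ → ℂ) : ℂ → ℂ :=
  fun z => Complex.exp (-(starRingEnd ℂ) c * z - (‖c‖ : ℂ) ^ 2 / 2) * f (z + c)

theorem norm_sq_weyl_mul_exp (c : ℂ) (f : ℂ → ℂ) (z : ℂ) :
    ‖weyl c f z‖ ^ 2 * Real.exp (-‖z‖ ^ 2) = ‖f (z + c)‖ ^ 2 * Real.exp (-‖z + c‖ ^ 2) := by
  rw [weyl, norm_mul, mul_pow, mul_right_comm, Complex.norm_exp, ← Real.exp_nat_mul,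
    ← Real.exp_add, mul_comm]
  congr 2
  rw [← Complex.normSq_eq_norm_sq, ← Complex.normSq_eq_norm_sq, ← Complex.ofReal_pow,
    ← Complex.normSq_eq_norm_sq]
  simp [Complex.normSq_apply, -Complex.ofReal_mul]
  ring

theorem MemFock.weyl {f : ℂ → ℂ} (hf : MemFock f) (c : ℂ) : MemFock (weyl c f) := by
  have := hf.1
  refine ⟨by unfold _root_.weyl; fun_prop, ?_⟩
  simp only [norm_sq_weyl_mul_exp]
  exact hf.2.comp_add_right c

theorem fockNormSq_weyl (c : ℂ) (f : ℂ → ℂ) : fockNormSq (weyl c f) = fockNormSq f := by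
  simp only [fockNormSq, norm_sq_weyl_mul_exp]
  rw [integral_add_right_eq_self (fun z : ℂ => ‖f z‖ ^ 2 * Real.exp (-‖z‖ ^ 2)) c]

theorem weyl_weyl (c d : ℂ) (f : ℂ → ℂ) (z : ℂ) :
    weyl c (weyl d f) z = Complex.exp ((c * (starRingEnd ℂ) d).im * -Complex.I)
      * weyl (c + d) f z := by
  simp only [weyl]
  rw [← mul_assoc, ← mul_assoc, ← Complex.exp_add, ← Complex.exp_add, add_assoc]
  congr 2
  have h1 : ∀ w : ℂ, (‖w‖ : ℂ) ^ 2 = w * (starRingEnd ℂ) w := fun w => by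
    rw [Complex.mul_conj, Complex.normSq_eq_norm_sq]; push_cast; rfl
  have h2 : ((c * (starRingEnd ℂ) d).im : ℂ)
      = (c * (starRingEnd ℂ) d - (starRingEnd ℂ) c * d) / (2 * Complex.I) := by
    have := Complex.im_eq_sub_conj (c * (starRingEnd ℂ) d)
    simpa using this
  rw [h1, h1, h1, h2, map_add]
  field_simp
  ring

theorem weyl_weyl_neg (c : ℂ) (f : ℂ → ℂ) : weyl c (weyl (-c) f) = f := by
  ext z
  have h : (c * (starRingEnd ℂ) (-c)).im = 0 := by
    rw [map_neg, mul_neg, Complex.mul_conj, Complex.neg_im, Complex.ofReal_im, neg_zero]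
  rw [weyl_weyl, h]
  simp [weyl]

theorem exists_norm_sq_apply_le_fockNormSq (z : ℂ) :
    ∃ K : ℝ, 0 ≤ K ∧ ∀ f, MemFock f → ‖f z‖ ^ 2 ≤ K * fockNormSq f := by
  refine ⟨Real.exp (‖z‖ ^ 2), (Real.exp_pos _).le, fun f hf => ?_⟩
  have h := norm_sq_apply_zero_le_fockNormSq (hf.weyl z)
  have h2 := norm_sq_weyl_mul_exp z f 0
  rw [fockNormSq_weyl] at h
  simp only [norm_zero, zero_add, ne_eq, OfNat.ofNat_ne_zero, not_false_eq_true, zero_pow,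
    neg_zero, Real.exp_zero, mul_one] at h2
  rw [h2, Real.exp_neg, ← div_eq_mul_inv, div_le_iff₀ (Real.exp_pos _)] at h
  linarith

theorem memFock_one : MemFock (fun _ => 1) :=
  ⟨differentiable_const _, by simp [integrable_exp_neg_normSq]⟩

theorem fockNormSq_one : fockNormSq (fun _ => 1) = 1 := by
  simp only [fockNormSq, norm_one, one_pow, one_mul, integral_exp_neg_normSq]
  field_simp

theorem exists_eq_const_of_fockBoundedOp_mulOp {V : ℂ → ℂ} (hV : Differentiable ℂ V)
    (hb : FockBoundedOp (mulOp V)) : ∃ c, ∀ z, V z = c := by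
  obtain ⟨hmem, C, hC, hle⟩ := hb
  have hpow : ∀ n : ℕ, MemFock (fun z => V z ^ n) ∧ fockNormSq (fun z => V z ^ n) ≤ (C + 1) ^ n := by
    intro n
    induction n with
    | zero => simp [fockNormSq_one, memFock_one]
    | succ n ih =>
      have e : (fun z => V z ^ (n + 1)) = mulOp V (fun z => V z ^ n) := by
        ext z; rw [mulOp, pow_succ']
      rw [e]
      refine ⟨hmem _ ih.1, (hle _ ih.1).trans ?_⟩
      rw [pow_succ']
      exact (mul_le_mul_of_nonneg_left ih.2 hC).trans (by gcongr; linarith)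
  have hbd : ∀ z, ‖V z‖ ^ 2 ≤ C + 1 := by
    intro z
    obtain ⟨K, hK, hKf⟩ := exists_norm_sq_apply_le_fockNormSq z
    by_contra! hlt
    have h1 : 1 < ‖V z‖ ^ 2 / (C + 1) := (one_lt_div (by positivity)).2 hlt
    obtain ⟨n, hn⟩ := pow_unbounded_of_one_lt K h1
    rw [div_pow, lt_div_iff₀ (by positivity)] at hn
    have h2 := (hKf _ (hpow n).1).trans (mul_le_mul_of_nonneg_left (hpow n).2 hK)
    rw [norm_pow, ← pow_mul, mul_comm n 2, pow_mul] at h2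
    linarith
  refine ⟨V 0, fun z => hV.apply_eq_apply_of_bounded ?_ z 0⟩
  refine (Metric.isBounded_closedBall (x := (0 : ℂ)) (r := C + 1 + 1)).subset ?_
  rintro _ ⟨z, rfl⟩
  rw [mem_closedBall_zero_iff]
  nlinarith [hbd z, sq_nonneg (‖V z‖ - 1)]

theorem MemFock.add {f g : ℂ → ℂ} (hf : MemFock f) (hg : MemFock g) : MemFock (f + g) := by
  refine ⟨hf.1.add hg.1, ((hf.2.const_mul 2).add (hg.2.const_mul 2)).mono' ?_
    (Filter.Eventually.of_forall fun z => ?_)⟩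
  · have := hf.1.continuous
    have := hg.1.continuous
    exact Continuous.aestronglyMeasurable (by fun_prop)
  · rw [Real.norm_of_nonneg (by positivity)]
    simp only [Pi.add_apply]
    rw [← mul_assoc, ← mul_assoc, ← add_mul]
    gcongr
    nlinarith [norm_add_le (f z) (g z), norm_nonneg (f z + g z), sq_nonneg (‖f z‖ - ‖g z‖)]

theorem MemFock.smul {f : ℂ → ℂ} (hf : MemFock f) (c : ℂ) : MemFock (c • f) := by
  refine ⟨hf.1.const_smul c, ?_⟩
  have := hf.2.const_mul (‖c‖ ^ 2)
  refine this.congr (Filter.Eventually.of_forall fun z => ?_)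
  simp only [Pi.smul_apply, smul_eq_mul, norm_mul]
  ring

/-- The Fock space as a subspace of the space of all functions. -/
def fockSubmodule : Submodule ℂ (ℂ → ℂ) where
  carrier := {f | MemFock f}
  add_mem' := MemFock.add
  zero_mem' := by simpa using! memFock_one.smul 0
  smul_mem' c _ hf := hf.smul c

/-- The Fock space, as a type carrying the norm topology. -/
def FockSpace : Type := fockSubmodule

namespace FockSpace

noncomputable instance : AddCommGroup FockSpace := inferInstanceAs (AddCommGroup fockSubmodule)

noncomputable instance : Module ℂ FockSpace := inferInstanceAs (Module ℂ fockSubmodule)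

/-- The inclusion of the Fock space into the space of all functions. -/
def toFun : FockSpace →ₗ[ℂ] (ℂ → ℂ) := fockSubmodule.subtype

/-- The element of the Fock space given by a function. -/
def mk (f : ℂ → ℂ) (hf : MemFock f) : FockSpace := ⟨f, hf⟩

@[simp] theorem toFun_mk (f : ℂ → ℂ) (hf : MemFock f) : toFun (mk f hf) = f := rfl

theorem memFock (f : FockSpace) : MemFock (toFun f) := f.2

@[ext] theorem ext {f g : FockSpace} (h : ∀ z, toFun f z = toFun g z) : f = g :=
  Subtype.ext (funext h)

theorem integrable_inner (f g : FockSpace) :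
    Integrable (fun z => toFun f z * (starRingEnd ℂ) (toFun g z) * (Real.exp (-‖z‖ ^ 2) : ℂ)) := by
  refine (f.memFock.2.add g.memFock.2).mono' ?_ (Filter.Eventually.of_forall fun z => ?_)
  · have := f.memFock.1.continuous
    have := g.memFock.1.continuous
    have h := Complex.continuous_conj
    exact Continuous.aestronglyMeasurable (by fun_prop)
  · simp only [norm_mul, RCLike.norm_conj, Complex.norm_real, Real.norm_eq_abs, Real.abs_exp,
      Pi.add_apply]
    rw [← add_mul]
    gcongr
    nlinarith [sq_nonneg (‖toFun f z‖ - ‖toFun g z‖), sq_nonneg (‖toFun f z‖),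
      sq_nonneg (‖toFun g z‖)]

theorem fockInner_self (f : ℂ → ℂ) : fockInner f f = (fockNormSq f : ℂ) := by
  have h : ∀ z, f z * (starRingEnd ℂ) (f z) * (Real.exp (-‖z‖ ^ 2) : ℂ)
      = ((‖f z‖ ^ 2 * Real.exp (-‖z‖ ^ 2) : ℝ) : ℂ) := fun z => by
    rw [Complex.mul_conj, Complex.normSq_eq_norm_sq, Complex.ofReal_mul]
  simp only [fockInner, fockNormSq, h, integral_complex_ofReal]
  push_cast
  rfl

theorem fockNormSq_nonneg (f : ℂ → ℂ) : 0 ≤ fockNormSq f :=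
  mul_nonneg (by positivity) (integral_nonneg fun z => by positivity)

theorem eq_zero_of_fockNormSq_eq_zero (f : FockSpace) (h : fockNormSq (toFun f) = 0) : f = 0 := by
  ext z
  obtain ⟨K, -, hK⟩ := exists_norm_sq_apply_le_fockNormSq z
  have := hK _ f.memFock
  rw [h, mul_zero] at this
  have h2 : ‖toFun f z‖ = 0 := by nlinarith [norm_nonneg (toFun f z)]
  simpa using h2

/-- The inner product of the Fock space. -/
@[reducible]
noncomputable def core : InnerProductSpace.Core ℂ FockSpace where
  inner f g := fockInner (toFun g) (toFun f)
  conj_inner_symm f g := by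
    simp only [fockInner, map_mul, ← integral_conj]
    simp [mul_comm, ← Complex.exp_conj]
  re_inner_nonneg f := by
    rw [fockInner_self]
    simpa using fockNormSq_nonneg _
  add_left f g h := by
    simp only [fockInner, map_add, Pi.add_apply, mul_add, add_mul]
    rw [integral_add (integrable_inner h f) (integrable_inner h g), mul_add]
  smul_left f g r := by
    simp only [fockInner, map_smul, Pi.smul_apply, smul_eq_mul, map_mul]
    rw [mul_left_comm, ← integral_const_mul ((starRingEnd ℂ) r)]
    congr 1
    exact congrArg (fun F : ℂ → ℂ => ∫ z, F z) (funext fun z => by ring)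
  definite f h := by
    rw [fockInner_self] at h
    exact eq_zero_of_fockNormSq_eq_zero f (by exact_mod_cast h)

noncomputable instance : NormedAddCommGroup FockSpace := core.toNormedAddCommGroup

noncomputable instance : InnerProductSpace ℂ FockSpace := InnerProductSpace.ofCore core.toCore

theorem norm_sq (f : FockSpace) : ‖f‖ ^ 2 = fockNormSq (toFun f) := by
  have h : (⟪f, f⟫_ℂ : ℂ) = fockNormSq (toFun f) := fockInner_self (toFun f)
  rw [inner_self_eq_norm_sq_to_K] at h
  apply Complex.ofReal_injective
  rw [← h, Complex.ofReal_pow]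
  rfl

/-- The Weyl operators as unitary operators on the Fock space. -/
noncomputable def weylEquiv (c : ℂ) : FockSpace ≃ₗᵢ[ℂ] FockSpace where
  toFun f := mk (weyl c (toFun f)) (f.memFock.weyl c)
  map_add' f g := by ext z; simp [weyl, mul_add]
  map_smul' r f := by ext z; simp [weyl, mul_left_comm]
  invFun f := mk (weyl (-c) (toFun f)) (f.memFock.weyl (-c))
  left_inv f := by
    ext z
    have h := weyl_weyl_neg (-c) (toFun f)
    rw [neg_neg] at h
    rw [toFun_mk, toFun_mk, h]
  right_inv f := by ext z; rw [toFun_mk, toFun_mk, weyl_weyl_neg]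
  norm_map' f := by
    rw [← sq_eq_sq₀ (norm_nonneg _) (norm_nonneg _), norm_sq, norm_sq]
    exact fockNormSq_weyl c _

@[simp] theorem toFun_weylEquiv (c : ℂ) (f : FockSpace) :
    toFun (weylEquiv c f) = weyl c (toFun f) := rfl

theorem weylEquiv_comm (c d : ℂ) (f : FockSpace) :
    weylEquiv c (weylEquiv d f) = Complex.exp ((c * (starRingEnd ℂ) d).im * (-2 * Complex.I)) •
      weylEquiv d (weylEquiv c f) := by
  ext z
  have h : (d * (starRingEnd ℂ) c).im = -(c * (starRingEnd ℂ) d).im := by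
    simp [Complex.mul_im]; ring
  rw [map_smul, Pi.smul_apply, smul_eq_mul]
  simp only [toFun_weylEquiv]
  rw [weyl_weyl, weyl_weyl, ← mul_assoc, ← Complex.exp_add, h, add_comm d c]
  congr 2
  push_cast
  ring

theorem not_finiteDimensional : ¬ FiniteDimensional ℂ FockSpace := by
  intro hfin
  have hmem : ∀ n : ℕ, MemFock (fun z => Complex.exp (n * z)) := by
    intro n
    convert! (memFock_one.weyl (-n)).smul (Complex.exp ((n : ℂ) ^ 2 / 2)) using 2 with z
    simp [weyl, ← Complex.exp_add]
  let χ : ℕ → (Multiplicative ℂ →* ℂ) := fun n =>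
    { toFun := fun z => Complex.exp (n * z.toAdd)
      map_one' := by simp
      map_mul' := fun x y => by simp [mul_add, Complex.exp_add] }
  have hχ : Function.Injective χ := by
    intro m n h
    have h1 : Complex.exp (m * 1) = Complex.exp (n * 1) :=
      DFunLike.congr_fun h (Multiplicative.ofAdd (1 : ℂ))
    have h2 : Real.exp m = Real.exp n := by
      rw [mul_one, mul_one] at h1
      exact Complex.ofReal_injective (by simpa using h1)
    exact_mod_cast Real.exp_injective h2
  have hli : LinearIndependent ℂ (fun n => (χ n : Multiplicative ℂ → ℂ)) :=
    (linearIndependent_monoidHom (Multiplicative ℂ) ℂ).comp χ hχ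
  have hli' : LinearIndependent ℂ (fun n => mk _ (hmem n)) := LinearIndependent.of_comp toFun hli
  exact not_finite_iff_infinite.2 (inferInstance : Infinite ℕ) hli'.finite

end FockSpace

theorem IsCyclicVec.exists_norm_sub_lt {T : (ℂ → ℂ) → ℂ → ℂ} {f : ℂ → ℂ} (hf : IsCyclicVec T f)
    {v : ℕ → FockSpace} (hv : ∀ i, FockSpace.toFun (v i) = T^[i] f) (g : FockSpace) {ε : ℝ}
    (hε : 0 < ε) : ∃ (n : ℕ) (c : Fin n → ℂ), ‖(∑ i, c i • v i) - g‖ < ε := by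
  obtain ⟨n, c, h⟩ := hf.2 _ g.memFock (ε ^ 2) (by positivity)
  refine ⟨n, c, (sq_lt_sq₀ (norm_nonneg _) hε.le).1 ?_⟩
  rw [FockSpace.norm_sq]
  have e : FockSpace.toFun ((∑ i, c i • v i) - g)
      = fun z => (∑ i : Fin n, c i * T^[(i : ℕ)] f z) - FockSpace.toFun g z := by
    ext z
    simp [hv]
  rwa [e]

theorem not_isCyclicOp_of_iterate_eq {T : (ℂ → ℂ) → ℂ → ℂ} (hT : ∀ f, MemFock f → MemFock (T f))
    (hsmul : ∀ (c : ℂ) f, T (c • f) = c • T f) {j m : ℕ} (hjm : j < m) {c : ℂ}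
    (h : ∀ f, T^[m] f = c • T^[j] f) : ¬ IsCyclicOp T := by
  rintro ⟨f, hf⟩
  have hmem : ∀ i, MemFock (T^[i] f) := fun i => by
    induction i with
    | zero => exact hf.1
    | succ i ih => rw [Function.iterate_succ_apply']; exact hT _ ih
  have hsmul' : ∀ (i : ℕ) (c : ℂ) f, T^[i] (c • f) = c • T^[i] f := fun i c => by
    induction i with
    | zero => simp
    | succ i ih => intro f; simp [hsmul, ih]
  let v : ℕ → FockSpace := fun i => FockSpace.mk _ (hmem i)
  let S : Submodule ℂ FockSpace := Submodule.span ℂ (v '' Set.Iio m)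
  have hvS : ∀ i, v i ∈ S := by
    intro i
    induction i using Nat.strong_induction_on with
    | _ i ih =>
      rcases lt_or_ge i m with hi | hi
      · exact Submodule.subset_span ⟨i, hi, rfl⟩
      · have : v i = c • v (i - m + j) := by
          ext z
          rw [map_smul]
          change T^[i] f z = (c • T^[i - m + j] f) z
          conv_lhs => rw [← Nat.sub_add_cancel hi, Function.iterate_add_apply, h, hsmul']
          rw [Function.iterate_add_apply]
        rw [this]
        exact S.smul_mem c (ih _ (by omega))
  have hfin : FiniteDimensional ℂ S :=
    FiniteDimensional.span_of_finite ℂ ((Set.finite_Iio m).image v)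
  have hclosed : IsClosed (S : Set FockSpace) := S.closed_of_finiteDimensional
  have htop : S = ⊤ := by
    refine eq_top_iff.2 fun g _ => ?_
    rw [← SetLike.mem_coe, ← hclosed.closure_eq, Metric.mem_closure_iff]
    intro ε hε
    obtain ⟨n, d, hd⟩ := hf.exists_norm_sub_lt (v := v) (fun _ => rfl) g hε
    exact ⟨_, S.sum_mem fun i _ => S.smul_mem (d i) (hvS i), by rwa [dist_comm, dist_eq_norm]⟩
  rw [htop] at hfin
  exact FockSpace.not_finiteDimensional
    (LinearEquiv.finiteDimensional (Submodule.topEquiv (R := ℂ) (M := FockSpace)))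

theorem not_isCyclicOp_of_eq_smul_weyl {T : (ℂ → ℂ) → ℂ → ℂ} {b c : ℂ} (hb : b ≠ 0)
    (hT : ∀ f, T f = c • weyl b f) : ¬ IsCyclicOp T := by
  rintro ⟨f, hf⟩
  let F : FockSpace := FockSpace.mk f hf.1
  let d : ℂ := Real.pi * Complex.I / (starRingEnd ℂ) b
  have hd : b * (starRingEnd ℂ) d = -(Real.pi * Complex.I) := by
    simp only [d, map_div₀, map_mul, Complex.conj_conj, Complex.conj_I, Complex.conj_ofReal]
    field_simp
  have hd2 : b / 2 * (starRingEnd ℂ) d = -(Real.pi * Complex.I) / 2 := by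
    rw [div_mul_eq_mul_div, hd]
  have hweyl : ∀ (i : ℕ) z, FockSpace.toFun (c ^ i • (FockSpace.weylEquiv b)^[i] F) z
      = T^[i] f z := by
    intro i
    induction i with
    | zero => intro z; simp [F]
    | succ i ih =>
      intro z
      rw [Function.iterate_succ_apply', Function.iterate_succ_apply', hT, ← funext ih]
      simp [weyl]
      ring
  have hzero : F = 0 := by
    refine eq_zero_of_anticommute_of_dense_orbit (FockSpace.weylEquiv b)
      (FockSpace.weylEquiv (b / 2)) (FockSpace.weylEquiv d) (fun x => ?_) (fun x => ?_)
      (fun x => ?_) F fun g ε hε => ?_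
    · rw [FockSpace.weylEquiv_comm]
      have : (b * (starRingEnd ℂ) (b / 2)).im = 0 := by
        rw [map_div₀, ← mul_div_assoc, Complex.mul_conj, Complex.conj_ofNat]
        simp
      rw [this]
      simp
    · rw [FockSpace.weylEquiv_comm, hd]
      have : ((-(Real.pi * Complex.I)).im : ℂ) * (-2 * Complex.I) = 2 * Real.pi * Complex.I := by
        simp; ring
      rw [this, Complex.exp_two_pi_mul_I, one_smul]
    · rw [FockSpace.weylEquiv_comm, hd2]
      have : ((-(Real.pi * Complex.I) / 2).im : ℂ) * (-2 * Complex.I) = Real.pi * Complex.I := by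
        simp; ring
      rw [this, Complex.exp_pi_mul_I, neg_one_smul]
    · obtain ⟨n, e, he⟩ := hf.exists_norm_sub_lt (fun i => funext (hweyl i)) g hε
      exact ⟨n, fun i => e i * c ^ (i : ℕ), by simpa only [mul_smul] using he⟩
  have hmem : ∀ i, FockSpace.toFun 0 = T^[i] f := fun i => by
    have h0 : (FockSpace.weylEquiv b)^[i] 0 = 0 := Function.iterate_fixed (map_zero _) i
    rw [← funext (hweyl i), hzero, h0, smul_zero]
  obtain ⟨n, e, he⟩ := hf.exists_norm_sub_lt hmem (FockSpace.mk _ memFock_one) one_pos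
  have h1 : ‖FockSpace.mk _ memFock_one‖ ^ 2 = 1 := by
    rw [FockSpace.norm_sq, FockSpace.toFun_mk, fockNormSq_one]
  simp only [smul_zero, Finset.sum_const_zero, zero_sub, norm_neg] at he
  nlinarith [norm_nonneg (FockSpace.mk _ memFock_one)]

theorem FockBoundedOp.iterate {T : (ℂ → ℂ) → ℂ → ℂ} (hT : FockBoundedOp T) (n : ℕ) :
    FockBoundedOp T^[n] := by
  induction n with
  | zero => exact ⟨fun _ h => h, 1, zero_le_one, fun f _ => by simp⟩
  | succ n ih =>
    obtain ⟨hm, C, hC, hle⟩ := hT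
    obtain ⟨hm', C', hC', hle'⟩ := ih
    refine ⟨fun f hf => hm' _ (hm _ hf), C' * C, by positivity, fun f hf => ?_⟩
    rw [mul_assoc]
    exact (hle' _ (hm _ hf)).trans (mul_le_mul_of_nonneg_left (hle _ hf) hC')

theorem wComp_smul (u ψ : ℂ → ℂ) (c : ℂ) (f : ℂ → ℂ) :
    wComp u ψ (c • f) = c • wComp u ψ f := by
  ext z
  simp [wComp, mul_left_comm]

theorem wComp_iterate (u ψ : ℂ → ℂ) (n : ℕ) (f : ℂ → ℂ) (z : ℂ) :
    (wComp u ψ)^[n] f z = (∏ i ∈ Finset.range n, u (ψ^[i] z)) * f (ψ^[n] z) := by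
  induction n generalizing f with
  | zero => simp
  | succ n ih =>
    rw [Function.iterate_succ_apply, ih, Finset.prod_range_succ, Function.iterate_succ_apply', wComp,
      mul_assoc]

/-- if a^k = a for some integer k ≥ 2 then the bounded weighted
composition operator W_{(u,ψ)} with ψ(z)=az+b is not cyclic on 𝓕₂. -/
theorem not_cyclic_of_pow_eq (u : ℂ → ℂ) (a b : ℂ)
    (hu : Differentiable ℂ u) (ha : ‖a‖ ≤ 1)
    (hbdd : FockBoundedOp (wComp u (fun z => a * z + b)))
    (hk : ∃ k : ℕ, 2 ≤ k ∧ a ^ k = a) :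
    ¬ IsCyclicOp (wComp u (fun z => a * z + b)) := by
  obtain ⟨k, hk2, hak⟩ := hk
  by_cases ha0 : a = 0
  · refine not_isCyclicOp_of_iterate_eq hbdd.1 (wComp_smul _ _) (j := 1) (m := 2) one_lt_two
      (c := u b) fun f => ?_
    ext z
    simp [wComp, ha0, mul_left_comm]
  by_cases hab : a = 1 ∧ b ≠ 0
  · obtain ⟨rfl, hb⟩ := hab
    let V : ℂ → ℂ := fun z => u z * Complex.exp ((starRingEnd ℂ) b * z + (‖b‖ : ℂ) ^ 2 / 2)
    have hV : ∀ f, wComp u (fun z => 1 * z + b) f = mulOp V (weyl b f) := by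
      intro f
      ext z
      simp only [wComp, mulOp, weyl, V, one_mul]
      rw [mul_assoc, ← mul_assoc (Complex.exp _), ← Complex.exp_add]
      simp
    have hVbdd : FockBoundedOp (mulOp V) := by
      have hinv : ∀ f, mulOp V f = wComp u (fun z => 1 * z + b) (weyl (-b) f) := by
        intro f
        rw [hV, weyl_weyl_neg]
      obtain ⟨hm, C, hC, hle⟩ := hbdd
      refine ⟨fun f hf => hinv f ▸ hm _ (hf.weyl _), C, hC, fun f hf => ?_⟩
      rw [hinv, ← fockNormSq_weyl (-b) f]
      exact hle _ (hf.weyl _)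
    obtain ⟨c, hc⟩ := exists_eq_const_of_fockBoundedOp_mulOp (by fun_prop) hVbdd
    refine not_isCyclicOp_of_eq_smul_weyl (c := c) hb fun f => ?_
    rw [hV]
    ext z
    simp [mulOp, hc]
  · obtain ⟨p, hp⟩ : ∃ p, b = p - a * p := by
      by_cases ha1 : a = 1
      · exact ⟨0, by simpa [ha1] using hab⟩
      · have : 1 - a ≠ 0 := sub_ne_zero.2 (Ne.symm ha1)
        exact ⟨b / (1 - a), by field_simp⟩
    have hψ : ∀ (n : ℕ) z, (fun z => a * z + b)^[n] z = a ^ n * (z - p) + p := by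
      intro n z
      induction n with
      | zero => simp
      | succ n ih => rw [Function.iterate_succ_apply', ih, hp]; ring
    have ham : a ^ (k - 1) = 1 := by
      apply mul_right_cancel₀ ha0
      rw [← pow_succ, Nat.sub_add_cancel (by omega), hak, one_mul]
    have hiter : (wComp u (fun z => a * z + b))^[k - 1]
        = mulOp (fun z => ∏ i ∈ Finset.range (k - 1), u (a ^ i * (z - p) + p)) := by
      ext f z
      simp only [wComp_iterate, hψ, ham, mulOp]
      simp
    have hb := hbdd.iterate (k - 1)
    rw [hiter] at hb
    obtain ⟨c, hc⟩ := exists_eq_const_of_fockBoundedOp_mulOp (by fun_prop) hb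
    refine not_isCyclicOp_of_iterate_eq hbdd.1 (wComp_smul _ _) (j := 0) (m := k - 1) (by omega)
      (c := c) fun f => ?_
    rw [hiter]
    ext z
    simp [mulOp, hc]
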